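/- Let R be a left Ore domain and A a quasi-commutative bijective skew PBW extension of R (equivalently, an iterated skew polynomial ring R[z₁;θ₁]⋯[zₙ;θₙ] with all θᵢ bijective and no derivations). Then A is a left Ore domain. -/

import Mathlib

open Module

/-- Left linear algebra over a left Ore domain satisfies the strong rank condition. -/
theorem strongRankCondition_of_leftOre {R : Type*} [Ring R] [IsDomain R]
    (ore : ∀ a b : R, a ≠ 0 → b ≠ 0 → ∃ a₁ b₁ : R, b₁ * a = a₁ * b ∧ b₁ * a ≠ 0) :
    StrongRankCondition R := by
  have dependent : ∀ (n : ℕ) (v : Fin (n + 1) → Fin n → R), ¬ LinearIndependent R v := by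
    intro n
    induction n with
    | zero => exact fun v hv => hv.ne_zero 0 (Subsingleton.elim _ _)
    | succ n ih =>
      intro v hv
      obtain ⟨j, hj⟩ : ∃ j, ∀ i, ∃ α β : R, α ≠ 0 ∧ α * v i 0 = β * v j 0 := by
        by_cases h : ∃ j, v j 0 ≠ 0
        · obtain ⟨j, hj⟩ := h
          refine ⟨j, fun i => ?_⟩
          by_cases hi : v i 0 = 0
          · exact ⟨1, 0, one_ne_zero, by simp [hi]⟩
          · obtain ⟨β, α, h, h0⟩ := ore _ _ hi hj
            exact ⟨α, β, left_ne_zero_of_mul h0, h⟩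
        · push Not at h
          exact ⟨0, fun i => ⟨1, 0, one_ne_zero, by simp [h]⟩⟩
      choose α β hα hαβ using hj
      refine ih (fun i => Fin.tail (α (j.succAbove i) • v (j.succAbove i)
        - β (j.succAbove i) • v j)) (Fintype.linearIndependent_iff.2 fun g hg i => ?_)
      have key := Fintype.linearIndependent_iff.1 hv
        (Fin.insertNth j (-∑ i, g i * β (j.succAbove i)) fun i => g i * α (j.succAbove i)) (by
          rw [Fin.sum_univ_succAbove _ j]
          simp only [Fin.insertNth_apply_same, Fin.insertNth_apply_succAbove]
          funext k
          simp only [Pi.add_apply, Pi.smul_apply, Finset.sum_apply, smul_eq_mul, Pi.zero_apply,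
            neg_mul, Finset.sum_mul, neg_add_eq_sub, ← Finset.sum_sub_distrib]
          refine Fin.cases ?_ (fun k => ?_) k
          · exact Finset.sum_eq_zero fun i _ => by rw [mul_assoc, mul_assoc, hαβ, sub_self]
          · have := congrFun hg k
            simpa [Fin.tail, mul_sub, mul_assoc] using this) (j.succAbove i)
      rw [Fin.insertNth_apply_succAbove] at key
      exact (mul_eq_zero.1 key).resolve_right (hα _)
  refine (strongRankCondition_iff_succ R).2 fun n f hf => ?_
  exact dependent n _ ((Pi.basisFun R (Fin (n + 1))).linearIndependent.map'
    f (LinearMap.ker_eq_bot.2 hf))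

section TwistedMonomialBasis

variable {R A I : Type*} [Ring R] [IsDomain R] [Ring A] [Module R A] [IsScalarTower R A A]

/-- A ring with a basis indexed by an additive monoid with unique sums, multiplying as monomials
up to nonzero scalars, has no zero divisors. -/
theorem mul_ne_zero_of_monomial_basis [Add I] [UniqueSums I] (b : Basis I R A)
    (hb : ∀ u v (s : R), s ≠ 0 → ∃ t : R, t ≠ 0 ∧ b u * (s • b v) = t • b (u + v))
    {f g : A} (hf : f ≠ 0) (hg : g ≠ 0) : f * g ≠ 0 := by
  classical
  have hsupp : ∀ {h : A}, h ≠ 0 → (b.repr h).support.Nonempty := fun hh =>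
    Finsupp.support_nonempty_iff.2 (by simpa using hh)
  obtain ⟨u, hu, v, hv, huv⟩ :=
    UniqueSums.uniqueAdd_of_nonempty (hsupp hf) (hsupp hg)
  have hfg : f * g = ∑ u ∈ (b.repr f).support, ∑ v ∈ (b.repr g).support,
      b.repr f u • (b u * (b.repr g v • b v)) := by
    conv_lhs => rw [← b.linearCombination_repr f, ← b.linearCombination_repr g]
    simp only [Finsupp.linearCombination_apply, Finsupp.sum, Finset.sum_mul_sum, smul_mul_assoc]
  intro h0
  have hcoef := congrArg (fun h => b.repr h (u + v)) (hfg.symm.trans h0)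
  simp only [map_sum, map_zero, Finsupp.coe_zero, Pi.zero_apply, Finsupp.finsetSum_apply,
    map_smul, Finsupp.smul_apply] at hcoef
  rw [Finset.sum_eq_single_of_mem u hu, Finset.sum_eq_single_of_mem v hv] at hcoef
  · obtain ⟨t, ht0, ht⟩ := hb u v _ (Finsupp.mem_support_iff.1 hv)
    rw [ht] at hcoef
    simp only [map_smul, Basis.repr_self, Finsupp.smul_apply, Finsupp.single_eq_same, smul_eq_mul,
      mul_one] at hcoef
    exact mul_ne_zero (Finsupp.mem_support_iff.1 hu) ht0 hcoef
  · intro v' hv' hne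
    obtain ⟨t, -, ht⟩ := hb u v' _ (Finsupp.mem_support_iff.1 hv')
    rw [ht, map_smul, Basis.repr_self, Finsupp.smul_apply, Finsupp.single_eq_of_ne, smul_zero,
      smul_zero]
    exact fun h => hne (huv hu hv' h.symm).2
  · intro u' hu' hne
    refine Finset.sum_eq_zero fun v' hv' => ?_
    obtain ⟨t, -, ht⟩ := hb u' v' _ (Finsupp.mem_support_iff.1 hv')
    rw [ht, map_smul, Basis.repr_self, Finsupp.smul_apply, Finsupp.single_eq_of_ne, smul_zero,
      smul_zero]
    exact fun h => hne (huv hu' hv' h.symm).1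

theorem exists_add_pow_lt_two_mul_pow (n m : ℕ) : ∃ d : ℕ, (d + m) ^ n < 2 * d ^ n := by
  rcases Nat.eq_zero_or_pos m with rfl | hm
  · exact ⟨1, by simp⟩
  refine ⟨(2 * n + 1) * m, ?_⟩
  have hbern := one_add_mul_le_pow (R := ℝ) (a := -1 / (2 * n + 2))
    (by rw [le_div_iff₀ (by positivity)]; nlinarith [(Nat.cast_nonneg n : (0 : ℝ) ≤ n)]) n
  have hhalf : (1 / 2 : ℝ) < 1 + n * (-1 / (2 * n + 2)) := by
    have : (n : ℝ) * (-1 / (2 * n + 2)) = -1 / 2 + 1 / (2 * n + 2) := by field_simp; ring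
    have : (0 : ℝ) < 1 / (2 * n + 2) := by positivity
    linarith
  have hbase : 1 + -1 / (2 * n + 2) = ((2 * n + 1) / (2 * n + 2) : ℝ) := by field_simp; ring
  rw [hbase, div_pow] at hbern
  have hlt := hhalf.trans_le hbern
  rw [lt_div_iff₀ (by positivity)] at hlt
  have hnat : (2 * n + 2) ^ n < 2 * (2 * n + 1) ^ n := by
    have : ((2 * n + 2 : ℝ)) ^ n < 2 * (2 * n + 1) ^ n := by linarith
    exact_mod_cast this
  calc ((2 * n + 1) * m + m) ^ n = (2 * n + 2) ^ n * m ^ n := by rw [← mul_pow]; ring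
    _ < 2 * (2 * n + 1) ^ n * m ^ n := by gcongr
    _ = 2 * ((2 * n + 1) * m) ^ n := by rw [mul_pow]; ring

/-- A ring with a monomial basis up to nonzero scalars over a ring with the strong rank
condition satisfies the left Ore condition: otherwise the left multiples of two elements by
small monomials would be independent and too numerous. -/
theorem leftOre_of_monomial_basis [StrongRankCondition R] {n : ℕ} (b : Basis (Fin n → ℕ) R A)
    (hb : ∀ u v (s : R), s ≠ 0 → ∃ t : R, t ≠ 0 ∧ b u * (s • b v) = t • b (u + v))
    {f g : A} (hf : f ≠ 0) (hg : g ≠ 0) : ∃ f₁ g₁ : A, g₁ * f = f₁ * g ∧ g₁ * f ≠ 0 := by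
  classical
  by_contra! hcon
  let box (d : ℕ) : Finset (Fin n → ℕ) := Fintype.piFinset fun _ => Finset.range d
  obtain ⟨m, hm⟩ : ∃ m, ∀ v ∈ (b.repr f).support ∪ (b.repr g).support, v ∈ box m := by
    refine ⟨(((b.repr f).support ∪ (b.repr g).support).sup fun v => ∑ i, v i) + 1,
      fun v hv => Fintype.mem_piFinset.2 fun i => Finset.mem_range.2 ?_⟩
    exact Nat.lt_succ_of_le ((Finset.single_le_sum (fun _ _ => Nat.zero_le _)
      (Finset.mem_univ i)).trans (Finset.le_sup (f := fun v : Fin n → ℕ => ∑ i, v i) hv))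
  obtain ⟨d, hd⟩ := exists_add_pow_lt_two_mul_pow n m
  have hspan : ∀ h : A, (b.repr h).support ⊆ box m → ∀ u ∈ box d,
      b u * h ∈ Submodule.span R (((box (d + m)).image b : Finset A) : Set A) := by
    intro h hh u hu
    rw [← b.linearCombination_repr h, Finsupp.linearCombination_apply, Finsupp.sum,
      Finset.mul_sum]
    refine Submodule.sum_mem _ fun v hv => ?_
    obtain ⟨t, -, ht⟩ := hb u v _ (Finsupp.mem_support_iff.1 hv)
    rw [ht]
    refine Submodule.smul_mem _ _ (Submodule.subset_span (Finset.mem_coe.2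
      (Finset.mem_image_of_mem _ (Fintype.mem_piFinset.2 fun i => Finset.mem_range.2 ?_))))
    exact add_lt_add (Finset.mem_range.1 (Fintype.mem_piFinset.1 hu i))
      (Finset.mem_range.1 (Fintype.mem_piFinset.1 (hh hv) i))
  have hzero : ∀ (c : box d → R) (h : A), h ≠ 0 → (∑ u, c u • b u) * h = 0 → c = 0 := by
    intro c h hh h0
    have : ∑ u, c u • b u = 0 := by
      by_contra hne
      exact mul_ne_zero_of_monomial_basis b hb hne hh h0
    exact funext (Fintype.linearIndependent_iff.1
      (b.linearIndependent.comp ((↑) : box d → Fin n → ℕ) Subtype.val_injective) c this)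
  have hind : LinearIndependent R
      (Sum.elim (fun u : box d => b u * f) fun u : box d => b u * g) := by
    refine Fintype.linearIndependent_iff.2 fun c hc => ?_
    simp only [Fintype.sum_sum_type, Sum.elim_inl, Sum.elim_inr, ← smul_mul_assoc,
      ← Finset.sum_mul] at hc
    have hl := hcon (-∑ u : box d, c (Sum.inr u) • b u) (∑ u : box d, c (Sum.inl u) • b u)
      (by rw [neg_mul]; exact eq_neg_of_add_eq_zero_left hc)
    rw [hl, zero_add] at hc
    rintro (u | u)
    · exact congrFun (hzero (fun u => c (Sum.inl u)) f hf hl) u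
    · exact congrFun (hzero (fun u => c (Sum.inr u)) g hg hc) u
  have hcard := linearIndependent_le_span' _ hind (((box (d + m)).image b : Finset A) : Set A) (by
    rintro _ ⟨u | u, rfl⟩
    · exact hspan f (fun v hv => hm v (Finset.mem_union_left _ hv)) u u.2
    · exact hspan g (fun v hv => hm v (Finset.mem_union_right _ hv)) u u.2)
  have hbox : ∀ d, (box d).card = d ^ n := fun d => by simp [box]
  have hcard' : 2 * d ^ n ≤ ((box (d + m)).image b).card := by
    rw [Cardinal.mk_fintype, Nat.cast_le] at hcard
    simpa [hbox, two_mul] using hcard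
  exact absurd (hcard'.trans (Finset.card_image_le.trans (hbox _).le)) hd.not_ge

end TwistedMonomialBasis

section ScalarCommutation

variable {R A : Type*} [Ring R] [Ring A] (φ : R →+* A)

/-- `y` can be moved past the scalars of `R` at the cost of an automorphism of `R`. -/
def Normalizes (y : A) : Prop := ∃ τ : R ≃+* R, ∀ r, y * φ r = φ (τ r) * y

/-- `y` and `z` commute up to a unit of `R`. -/
def UnitCommute (y z : A) : Prop := ∃ w : Rˣ, z * y = φ w * (y * z)

variable {φ}

theorem Normalizes.one : Normalizes φ 1 := ⟨RingEquiv.refl R, fun r => by simp⟩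

theorem Normalizes.mul {y z : A} : Normalizes φ y → Normalizes φ z → Normalizes φ (y * z) := by
  rintro ⟨τ, hτ⟩ ⟨ρ, hρ⟩
  exact ⟨ρ.trans τ, fun r => by rw [mul_assoc, hρ, ← mul_assoc, hτ, mul_assoc]; rfl⟩

theorem Normalizes.pow {y : A} (hy : Normalizes φ y) (k : ℕ) : Normalizes φ (y ^ k) := by
  induction k with
  | zero => simpa using Normalizes.one
  | succ k ih => rw [pow_succ]; exact ih.mul hy

theorem Normalizes.list_prod {l : List A} (hl : ∀ y ∈ l, Normalizes φ y) :
    Normalizes φ l.prod := by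
  induction l with
  | nil => exact Normalizes.one
  | cons y l ih =>
    rw [List.prod_cons]
    exact (hl y (by simp)).mul (ih fun z hz => hl z (by simp [hz]))

theorem Normalizes.exists_unit {y : A} (hy : Normalizes φ y) (w : Rˣ) :
    ∃ w' : Rˣ, y * φ w = φ w' * y := by
  obtain ⟨τ, hτ⟩ := hy
  exact ⟨Units.map (τ : R →* R) w, by simp [hτ]⟩

theorem UnitCommute.symm {y z : A} : UnitCommute φ y z → UnitCommute φ z y := by
  rintro ⟨w, hw⟩
  exact ⟨w⁻¹, by rw [hw, ← mul_assoc, ← map_mul, Units.inv_mul, map_one, one_mul]⟩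

theorem UnitCommute.one_right (y : A) : UnitCommute φ y 1 := ⟨1, by simp⟩

theorem UnitCommute.mul_right {y z z' : A} (hz : Normalizes φ z) :
    UnitCommute φ y z → UnitCommute φ y z' → UnitCommute φ y (z * z') := by
  rintro ⟨w, hw⟩ ⟨w', hw'⟩
  obtain ⟨w'', hw''⟩ := hz.exists_unit w'
  refine ⟨w'' * w, ?_⟩
  calc z * z' * y = z * φ w' * (y * z') := by rw [mul_assoc, hw', mul_assoc]
    _ = φ w'' * (z * y) * z' := by rw [hw'']; simp only [mul_assoc]
    _ = _ := by rw [hw]; simp only [mul_assoc, Units.val_mul, map_mul]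

theorem UnitCommute.pow_right {y z : A} (hz : Normalizes φ z) (h : UnitCommute φ y z) (k : ℕ) :
    UnitCommute φ y (z ^ k) := by
  induction k with
  | zero => simpa using UnitCommute.one_right y
  | succ k ih => rw [pow_succ]; exact ih.mul_right (hz.pow k) h

theorem UnitCommute.list_prod_right {y : A} {l : List A} (hl : ∀ z ∈ l, Normalizes φ z)
    (h : ∀ z ∈ l, UnitCommute φ y z) : UnitCommute φ y l.prod := by
  induction l with
  | nil => exact UnitCommute.one_right y
  | cons z l ih =>
    rw [List.prod_cons]
    exact (h z (by simp)).mul_right (hl z (by simp))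
      (ih (fun z hz => hl z (by simp [hz])) fun z hz => h z (by simp [hz]))

theorem exists_unit_monomial_mul {ι : Type*} {x : ι → A} (hx : ∀ i, Normalizes φ (x i))
    (hxx : ∀ i j, UnitCommute φ (x i) (x j)) (l : List ι) (u v : ι → ℕ) :
    ∃ w : Rˣ, (l.map fun i => x i ^ u i).prod * (l.map fun i => x i ^ v i).prod =
      φ w * (l.map fun i => x i ^ (u + v) i).prod := by
  induction l with
  | nil => exact ⟨1, by simp⟩
  | cons i l ih =>
    obtain ⟨w, hw⟩ := ih
    simp only [List.map_cons, List.prod_cons]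
    set P := (l.map fun i => x i ^ u i).prod
    set Q := (l.map fun i => x i ^ v i).prod
    obtain ⟨w₁, hw₁⟩ : UnitCommute φ (x i ^ v i) P := by
      refine UnitCommute.list_prod_right ?_ ?_ <;> simp only [List.mem_map] <;>
        rintro _ ⟨j, -, rfl⟩
      · exact (hx j).pow _
      · exact ((hxx j i).pow_right (hx i) _).symm.pow_right (hx j) _
    obtain ⟨w₂, hw₂⟩ := ((hx i).pow (u i)).exists_unit w₁
    obtain ⟨w₃, hw₃⟩ := ((hx i).pow (u i + v i)).exists_unit w
    refine ⟨w₂ * w₃, ?_⟩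
    calc x i ^ u i * P * (x i ^ v i * Q) = x i ^ u i * (P * x i ^ v i) * Q := by
          simp only [mul_assoc]
      _ = x i ^ u i * φ w₁ * (x i ^ v i * (P * Q)) := by rw [hw₁]; simp only [mul_assoc]
      _ = φ w₂ * (x i ^ (u i + v i) * (P * Q)) := by rw [hw₂, pow_add]; simp only [mul_assoc]
      _ = φ w₂ * (x i ^ (u i + v i) * φ w * (l.map fun i => x i ^ (u + v) i).prod) := by
          rw [hw]; simp only [mul_assoc]
      _ = _ := by rw [hw₃]; simp only [mul_assoc, Units.val_mul, map_mul, Pi.add_apply]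

end ScalarCommutation


/-- Let R be a left Ore domain and A a quasi-commutative bijective skew PBW
extension of R: A is a free left R-module with basis the standard monomials
x₁^{u₁}⋯xₙ^{uₙ}, with xᵢ·r = σᵢ(r)·xᵢ for automorphisms σᵢ of R and
xⱼxᵢ = cᵢⱼxᵢxⱼ with cᵢⱼ invertible. Then A is a left Ore domain. -/
theorem stmt_18 {R A : Type*} [Ring R] [IsDomain R] [Ring A]
    (oreR : ∀ a b : R, a ≠ 0 → b ≠ 0 → ∃ a₁ b₁ : R, b₁ * a = a₁ * b ∧ b₁ * a ≠ 0)
    (n : ℕ) (emb : R →+* A) (hemb : Function.Injective emb)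
    (x : Fin n → A)
    (basis : ∀ f : A, ∃! c : (Fin n → ℕ) →₀ R,
      f = c.sum fun u r =>
        emb r * ((List.finRange n).map fun i => x i ^ u i).prod)
    (σ : Fin n → R ≃+* R)
    (hx : ∀ (i : Fin n) (r : R), x i * emb r = emb (σ i r) * x i)
    (c : Fin n → Fin n → Rˣ)
    (hc : ∀ i j : Fin n, x j * x i = emb (c i j) * (x i * x j)) :
    (∀ a b : A, a ≠ 0 → b ≠ 0 → a * b ≠ 0) ∧
    (∀ a b : A, a ≠ 0 → b ≠ 0 → ∃ a₁ b₁ : A, b₁ * a = a₁ * b ∧ b₁ * a ≠ 0) := by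
  let _ : Module R A := Module.compHom A emb
  have smul_def : ∀ (r : R) (a : A), r • a = emb r * a := fun _ _ => rfl
  have : IsScalarTower R A A := ⟨fun r a b => by simp only [smul_def, smul_eq_mul, mul_assoc]⟩
  let X (u : Fin n → ℕ) : A := ((List.finRange n).map fun i => x i ^ u i).prod
  have hX : ∀ d : (Fin n → ℕ) →₀ R, Finsupp.linearCombination R X d =
      d.sum fun u r => emb r * ((List.finRange n).map fun i => x i ^ u i).prod := fun _ => rfl
  have hli : LinearIndependent R X := fun d e hde =>
    (basis _).unique (hX d) (hde.trans (hX e))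
  have hsp : ⊤ ≤ Submodule.span R (Set.range X) := fun f _ => by
    obtain ⟨d, hd, -⟩ := basis f
    exact hd ▸ Finsupp.mem_span_range_iff_exists_finsupp.2 ⟨d, rfl⟩
  let b := Basis.mk hli hsp
  have hnorm : ∀ i, Normalizes emb (x i) := fun i => ⟨σ i, hx i⟩
  have hb : ∀ u v (s : R), s ≠ 0 → ∃ t : R, t ≠ 0 ∧ b u * (s • b v) = t • b (u + v) := by
    intro u v s hs
    obtain ⟨τ, hτ⟩ : Normalizes emb (X u) := Normalizes.list_prod (by
      simp only [List.mem_map]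
      rintro _ ⟨i, -, rfl⟩
      exact (hnorm i).pow _)
    obtain ⟨w, hw⟩ := exists_unit_monomial_mul hnorm (fun i j => ⟨c i j, hc i j⟩)
      (List.finRange n) u v
    refine ⟨τ s * w, mul_ne_zero (by simpa using hs) w.ne_zero, ?_⟩
    simp only [b, Basis.mk_apply, smul_def]
    rw [← mul_assoc, hτ, mul_assoc, map_mul, mul_assoc]
    exact congrArg _ hw
  have := strongRankCondition_of_leftOre oreR
  exact ⟨fun f g hf hg => mul_ne_zero_of_monomial_basis b hb hf hg,
    fun f g hf hg => leftOre_of_monomial_basis b hb hf hg⟩
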